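/- For every l ≥ 1, every h ∈ {1,…,D} and all indices i_1,…,i_l ∈ {1,…,D}: x^h·X_l^{i_1…i_l} − X_{l+1}^{h i_1…i_l} = (l/(D+2l−2))·r²·𝒫^l{}^{i_1 i_2…i_l}_{h j_2…j_l} X_{l−1}^{j_2…j_l} (sum over j_2,…,j_l), where r² = Σ_i (x^i)². -/

import Mathlib

open scoped BigOperators

noncomputable section
namespace Fuzzy

/-- Matrices acting on `ℂ^D ⊗ ℂ^D`, indexed by pairs. -/
abbrev PairMat (D : ℕ) := Matrix (Fin D × Fin D) (Fin D × Fin D) ℂ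

/-- The flip (permutation) operator `𝖯` on `ℂ^D ⊗ ℂ^D`: `𝖯^{hi}_{jk} = δ^h_k δ^i_j`. -/
def flipMat (D : ℕ) : PairMat D := fun p q => if p.1 = q.2 ∧ p.2 = q.1 then 1 else 0

/-- The trace projector `𝒫ᵗ`: `𝒫ᵗ{}^{hi}_{jk} = δ^{hi} δ_{jk} / D`. -/
def traceMat (D : ℕ) : PairMat D :=
  fun p q => (if p.1 = p.2 then 1 else 0) * (if q.1 = q.2 then 1 else 0) / (D : ℂ)

/-- The symmetric projector `𝒫⁺ = (1 + 𝖯)/2`. -/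
def symPlusMat (D : ℕ) : PairMat D := (2 : ℂ)⁻¹ • ((1 : PairMat D) + flipMat D)

/-- The antisymmetric projector `𝒫⁻ = (1 − 𝖯)/2`. -/
def symMinusMat (D : ℕ) : PairMat D := (2 : ℂ)⁻¹ • ((1 : PairMat D) - flipMat D)

/-- The trace-free symmetric projector `𝒫 = 𝒫⁺ − 𝒫ᵗ`. -/
def PsMat (D : ℕ) : PairMat D := symPlusMat D - traceMat D

/-- `𝒫′ = 𝒫⁻ + 𝒫ᵗ`. -/
def PprimeMat (D : ℕ) : PairMat D := symMinusMat D + traceMat D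

/-- Embedding of an operator on `ℂ^D ⊗ ℂ^D` acting on the tensor factors `n, n+1`
(0-based) of `(ℂ^D)^{⊗ l}`, and as the identity on the other factors. -/
def embAt (D l n : ℕ) (A : PairMat D) :
    Matrix (Fin l → Fin D) (Fin l → Fin D) ℂ := fun i j =>
  if h : n + 1 < l then
    A (i ⟨n, Nat.lt_of_succ_lt h⟩, i ⟨n + 1, h⟩) (j ⟨n, Nat.lt_of_succ_lt h⟩, j ⟨n + 1, h⟩) *
      ∏ m : Fin l, (if m.val = n ∨ m.val = n + 1 then 1 else if i m = j m then 1 else 0)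
  else 0

/-- Extension of an operator on `(ℂ^D)^{⊗ l}` to `(ℂ^D)^{⊗ (l+1)}`, acting as the
identity on the last tensor factor. -/
def extendLast (D l : ℕ) (A : Matrix (Fin l → Fin D) (Fin l → Fin D) ℂ) :
    Matrix (Fin (l + 1) → Fin D) (Fin (l + 1) → Fin D) ℂ := fun i j =>
  A (fun m => i m.castSucc) (fun m => j m.castSucc) *
    (if i (Fin.last l) = j (Fin.last l) then 1 else 0)

/-- Extension of an operator on `(ℂ^D)^{⊗ l}` to `(ℂ^D)^{⊗ (l+1)}`, acting as the
identity on the first tensor factor. -/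
def extendFirst (D l : ℕ) (A : Matrix (Fin l → Fin D) (Fin l → Fin D) ℂ) :
    Matrix (Fin (l + 1) → Fin D) (Fin (l + 1) → Fin D) ℂ := fun i j =>
  A (fun m => i m.succ) (fun m => j m.succ) * (if i 0 = j 0 then 1 else 0)

/-- The matrix `M(l+1) = (1/(l+1)) [1 + l·𝖯 − (2Dl/(D+2l−2))·𝒫ᵗ]`. -/
def MStep (D l : ℕ) : PairMat D :=
  ((l : ℂ) + 1)⁻¹ •
    ((1 : PairMat D) + (l : ℂ) • flipMat D -
      (2 * (D : ℂ) * (l : ℂ) / ((D : ℂ) + 2 * (l : ℂ) - 2)) • traceMat D)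

/-- The completely symmetric trace-free projector `𝒫^l` on `(ℂ^D)^{⊗ l}`, defined
recursively by `𝒫^1 = id`, `𝒫^{l+1} = 𝒫^l_{1…l} M(l+1)_{l(l+1)} 𝒫^l_{1…l}`. -/
def symProj (D : ℕ) : (l : ℕ) → Matrix (Fin l → Fin D) (Fin l → Fin D) ℂ
  | 0 => 1
  | 1 => 1
  | (l + 2) =>
      extendLast D (l + 1) (symProj D (l + 1)) * embAt D (l + 2) l (MStep D (l + 1)) *
        extendLast D (l + 1) (symProj D (l + 1))


open MvPolynomial

/-- Complex polynomials in `E` variables. -/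
abbrev Poly (E : ℕ) := MvPolynomial (Fin E) ℂ

/-- The Laplacian `Δ = Σ_i ∂_i ∂_i`. -/
def lap {E : ℕ} (φ : Poly E) : Poly E := ∑ i : Fin E, pderiv i (pderiv i φ)

/-- The angular momentum operator `L_{ij} = i (x^j ∂_i − x^i ∂_j)`. -/
def ang {E : ℕ} (i j : Fin E) (φ : Poly E) : Poly E :=
  Complex.I • (X j * pderiv i φ - X i * pderiv j φ)

/-- The square angular momentum `L² = (1/2) Σ_{i,j} L_{ij} L_{ij}`. -/
def lsq {E : ℕ} (φ : Poly E) : Poly E :=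
  (2 : ℂ)⁻¹ • ∑ i : Fin E, ∑ j : Fin E, ang i j (ang i j φ)

/-- The Euler (dilatation) operator `η = Σ_i x^i ∂_i`. -/
def eta {E : ℕ} (φ : Poly E) : Poly E := ∑ i : Fin E, X i * pderiv i φ

/-- `r² = Σ_i (x^i)²`. -/
def r2 (E : ℕ) : Poly E := ∑ i : Fin E, X i * X i

/-- The harmonic polynomials `X_l^{i_1…i_l} := 𝒫^l{}^{i_1…i_l}_{j_1…j_l} x^{j_1} ⋯ x^{j_l}`. -/
def harmX (E l : ℕ) (i : Fin l → Fin E) : Poly E :=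
  ∑ j : Fin l → Fin E, symProj E l i j • ∏ m : Fin l, X (j m)

end Fuzzy

namespace Fuzzy

open MvPolynomial



/-! ### The apolar pairing on polynomials -/

/-- Weight `α! = ∏ α_i!`. -/
def wt {D : ℕ} (a : Fin D →₀ ℕ) : ℂ := ∏ i, ((a i).factorial : ℂ)

/-- The apolar pairing `⟨p, q⟩ = p(∂) q |_{x=0}`. -/
def pr (D : ℕ) : Poly D →ₗ[ℂ] Poly D →ₗ[ℂ] ℂ :=
  (basisMonomials (Fin D) ℂ).constr ℂ (fun a => wt a • lcoeff ℂ a)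

lemma pr_monomial {D : ℕ} (a : Fin D →₀ ℕ) (q : Poly D) :
    pr D (monomial a 1) q = wt a * coeff a q := by
  have := (basisMonomials (Fin D) ℂ).constr_basis ℂ (fun a => wt a • lcoeff ℂ a) a
  rw [coe_basisMonomials] at this
  rw [pr, this]
  simp

lemma pr_symm {D : ℕ} (p q : Poly D) : pr D p q = pr D q p := by
  have : pr D = (pr D).flip := by
    apply (basisMonomials (Fin D) ℂ).ext
    intro a
    apply (basisMonomials (Fin D) ℂ).ext
    intro b
    simp only [coe_basisMonomials, LinearMap.flip_apply, pr_monomial, coeff_monomial]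
    by_cases h : a = b
    · simp [h]
    · simp [h, Ne.symm h]
  conv_lhs => rw [this]
  rfl

lemma wt_add_single {D : ℕ} (a : Fin D →₀ ℕ) (i : Fin D) :
    wt (a + Finsupp.single i 1) = ((a i : ℂ) + 1) * wt a := by
  unfold wt
  rw [← Finset.mul_prod_erase _ _ (Finset.mem_univ i),
    ← Finset.mul_prod_erase Finset.univ (fun i => ((a i).factorial : ℂ)) (Finset.mem_univ i)]
  rw [Finset.prod_congr rfl (g := fun i => ((a i).factorial : ℂ))]
  · simp [Nat.factorial_succ]; ring
  · intro x hx
    have : i ≠ x := (Finset.ne_of_mem_erase hx).symm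
    simp [Finsupp.single_apply, this]

lemma pr_X_mul {D : ℕ} (i : Fin D) (p q : Poly D) :
    pr D (X i * p) q = pr D p (pderiv i q) := by
  have : (pr D).flip q ∘ₗ LinearMap.mulLeft ℂ (X i : Poly D)
      = (pr D).flip (pderiv i q) := by
    apply (basisMonomials (Fin D) ℂ).ext
    intro a
    simp only [coe_basisMonomials, LinearMap.comp_apply, LinearMap.flip_apply,
      LinearMap.mulLeft_apply]
    rw [show (X i : Poly D) * monomial a 1 = monomial (a + Finsupp.single i 1) 1 by
      rw [X, monomial_mul, add_comm, one_mul]]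
    rw [pr_monomial, pr_monomial, wt_add_single, coeff_pderiv]
    ring
  exact LinearMap.congr_fun this p

lemma pr_one_C {D : ℕ} (c : ℂ) : pr D 1 (C c) = c := by
  have := pr_monomial (0 : Fin D →₀ ℕ) (C c)
  rw [show (monomial (0 : Fin D →₀ ℕ) (1 : ℂ)) = 1 from rfl] at this
  rw [this]; simp [wt]

lemma pderiv_comm' {D : ℕ} (i j : Fin D) (p : Poly D) :
    pderiv i (pderiv j p) = pderiv j (pderiv i p) := by
  ext a
  simp only [coeff_pderiv]
  rw [add_right_comm]
  by_cases h : i = j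
  · subst h; rfl
  · simp [Finsupp.single_apply, h, Ne.symm h]; ring

lemma pr_r2_mul {D : ℕ} (p q : Poly D) : pr D (r2 D * p) q = pr D p (lap q) := by
  simp only [r2, lap, Finset.sum_mul, map_sum, LinearMap.sum_apply, mul_assoc, pr_X_mul]

/-! ### Laplacian calculus -/

/-- The Laplacian as a linear map. -/
def lapL (D : ℕ) : Poly D →ₗ[ℂ] Poly D :=
  ∑ i : Fin D, (pderiv i).toLinearMap ∘ₗ (pderiv i).toLinearMap

lemma lapL_apply {D : ℕ} (p : Poly D) : lapL D p = lap p := by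
  simp [lapL, lap]

lemma lap_pderiv {D : ℕ} (i : Fin D) (p : Poly D) : lap (pderiv i p) = pderiv i (lap p) := by
  simp only [lap, map_sum]
  refine Finset.sum_congr rfl fun j _ => ?_
  rw [pderiv_comm' j i, pderiv_comm' j i]

lemma pderiv_X' {D : ℕ} (i j : Fin D) :
    pderiv i (X j : Poly D) = if i = j then 1 else 0 := by
  rw [pderiv_X, Pi.single_apply]
  simp [eq_comm]

lemma lap_X_mul {D : ℕ} (h : Fin D) (p : Poly D) :
    lap (X h * p) = 2 * pderiv h p + X h * lap p := by
  simp only [lap, pderiv_mul, pderiv_X', map_add, Finset.sum_add_distrib, Finset.mul_sum]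
  simp only [ite_mul, one_mul, zero_mul, apply_ite (pderiv _), map_zero]
  simp
  ring

lemma lap_r2_mul {D : ℕ} (p : Poly D) :
    lap (r2 D * p) = 2 * (D : Poly D) * p + 4 * (∑ i, X i * pderiv i p) + r2 D * lap p := by
  rw [r2, Finset.sum_mul, ← lapL_apply, map_sum]
  simp only [lapL_apply, mul_assoc, lap_X_mul, pderiv_mul, pderiv_X']
  simp [Finset.sum_add_distrib, Finset.mul_sum, Finset.sum_mul, mul_add]
  simp only [← Finset.mul_sum, ← Finset.sum_add_distrib]
  simp only [Finset.mul_sum, ← Finset.sum_add_distrib, mul_assoc]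
  rw [← sub_eq_zero]
  have : (∑ x : Fin D, (2 * (X x * pderiv x p) + (X x * (2 * pderiv x p) + X x * (X x * lap p))))
    = ∑ x : Fin D, (4 * (X x * pderiv x p) + X x * (X x * lap p)) :=
    Finset.sum_congr rfl fun x _ => by ring
  simp [Finset.sum_add_distrib] at this ⊢
  linear_combination this

lemma pderiv_r2 {D : ℕ} (i : Fin D) : pderiv i (r2 D) = 2 * X i := by
  simp only [r2, map_sum, pderiv_mul, pderiv_X']
  simp [Finset.sum_add_distrib]
  ring

/-! ### Harmonic polynomials and tensors -/

/-- Homogeneous harmonic polynomials of degree `l`. -/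
def Harm {D : ℕ} (l : ℕ) (f : Poly D) : Prop := f.IsHomogeneous l ∧ lap f = 0

/-- The symmetric tensor of a polynomial. -/
def tens {D : ℕ} (l : ℕ) (f : Poly D) : (Fin l → Fin D) → ℂ :=
  fun i => pr D (∏ m, X (i m)) f

/-- The polynomial of a tensor. -/
def Phi {D : ℕ} (l : ℕ) (A : (Fin l → Fin D) → ℂ) : Poly D :=
  ∑ i, A i • ∏ m, X (i m)

lemma sum_snoc {D l : ℕ} {M : Type*} [AddCommMonoid M] (F : (Fin (l + 1) → Fin D) → M) :
    ∑ i, F i = ∑ a : Fin D, ∑ k : Fin l → Fin D, F (Fin.snoc k a) := by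
  rw [← Fintype.sum_prod_type']
  exact ((Fin.snocEquiv (fun _ : Fin (l + 1) => Fin D)).sum_comp F).symm

lemma prod_snoc {D l : ℕ} (k : Fin l → Fin D) (a : Fin D) :
    ∏ m, (X ((Fin.snoc k a : Fin (l + 1) → Fin D) m) : Poly D) = X a * ∏ m, X (k m) := by
  rw [Fin.prod_univ_castSucc]
  simp [mul_comm]

lemma prod_cons {D l : ℕ} (k : Fin l → Fin D) (a : Fin D) :
    ∏ m, (X ((Fin.cons a k : Fin (l + 1) → Fin D) m) : Poly D) = X a * ∏ m, X (k m) := by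
  rw [Fin.prod_univ_succ]
  simp

lemma tens_snoc {D l : ℕ} (f : Poly D) (k : Fin l → Fin D) (a : Fin D) :
    tens (l + 1) f (Fin.snoc k a) = tens l (pderiv a f) k := by
  rw [tens, prod_snoc, pr_X_mul]; rfl

lemma tens_cons {D l : ℕ} (f : Poly D) (k : Fin l → Fin D) (a : Fin D) :
    tens (l + 1) f (Fin.cons a k) = tens l (pderiv a f) k := by
  rw [tens, prod_cons, pr_X_mul]; rfl

lemma Phi_succ {D l : ℕ} (A : (Fin (l + 1) → Fin D) → ℂ) :
    Phi (l + 1) A = ∑ a, X a * Phi l (fun k => A (Fin.snoc k a)) := by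
  simp only [Phi, sum_snoc (l := l), prod_snoc, Finset.mul_sum, mul_smul_comm]

lemma Phi_tens {D l : ℕ} (f : Poly D) (hf : f.IsHomogeneous l) :
    Phi l (tens l f) = (l.factorial : ℂ) • f := by
  induction l generalizing f with
  | zero =>
    obtain ⟨c, rfl⟩ : ∃ c, f = C c :=
      ⟨_, (totalDegree_eq_zero_iff_eq_C.1 ((totalDegree_zero_iff_isHomogeneous _).2 hf))⟩
    simp [Phi, tens, pr_one_C, smul_eq_C_mul]
  | succ l ih =>
    rw [Phi_succ]
    have : ∀ a, (fun k : Fin l → Fin D => tens (l + 1) f (Fin.snoc k a)) = tens l (pderiv a f) :=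
      fun a => funext fun k => tens_snoc f k a
    simp only [this]
    rw [Finset.sum_congr rfl fun a _ => by rw [ih (pderiv a f) hf.pderiv]]
    have e := hf.sum_X_mul_pderiv
    simp only [mul_smul_comm, ← Finset.smul_sum, e, Nat.factorial_succ]
    rw [← Nat.cast_smul_eq_nsmul ℂ, smul_smul]
    push_cast
    rw [mul_comm]

lemma sum_mul_tens {D l : ℕ} (A : (Fin l → Fin D) → ℂ) (f : Poly D) :
    ∑ i, A i * tens l f i = pr D (Phi l A) f := by
  simp [Phi, tens, LinearMap.sum_apply]

lemma tens_smul {D l : ℕ} (c : ℂ) (f : Poly D) : tens l (c • f) = c • tens l f := by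
  ext i; simp [tens]

lemma Harm.pderiv {D l : ℕ} {f : Poly D} (hf : Harm (l + 1) f) (a : Fin D) :
    Harm l (MvPolynomial.pderiv a f) :=
  ⟨hf.1.pderiv, by rw [lap_pderiv, hf.2, map_zero]⟩

lemma homog_smul {D l : ℕ} {f : Poly D} (hf : f.IsHomogeneous l) (c : ℂ) :
    (c • f).IsHomogeneous l := by
  rw [smul_eq_C_mul]; exact hf.C_mul c

lemma lap_smul {D : ℕ} (c : ℂ) (f : Poly D) : lap (c • f) = c • lap f := by
  simp only [← lapL_apply, map_smul]
lemma lap_add {D : ℕ} (f g : Poly D) : lap (f + g) = lap f + lap g := by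
  simp only [← lapL_apply, map_add]
lemma lap_sub {D : ℕ} (f g : Poly D) : lap (f - g) = lap f - lap g := by
  simp only [← lapL_apply, map_sub]
lemma lap_sum {D : ℕ} {ι : Type*} (s : Finset ι) (f : ι → Poly D) :
    lap (∑ i ∈ s, f i) = ∑ i ∈ s, lap (f i) := by
  simp only [← lapL_apply, map_sum]

lemma Harm.smul {D l : ℕ} {f : Poly D} (hf : Harm l f) (c : ℂ) : Harm l (c • f) :=
  ⟨homog_smul hf.1 c, by rw [lap_smul, hf.2, smul_zero]⟩

lemma Harm.sub {D l : ℕ} {f g : Poly D} (hf : Harm l f) (hg : Harm l g) : Harm l (f - g) :=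
  ⟨hf.1.sub hg.1, by rw [lap_sub, hf.2, hg.2, sub_zero]⟩

lemma r2_homog {D : ℕ} : (r2 D).IsHomogeneous 2 :=
  IsHomogeneous.sum _ _ _ fun i _ => (isHomogeneous_X ℂ i).mul (isHomogeneous_X ℂ i)

/-- The raising construction: from harmonic `f_m` of degree `n ≥ 1`, a harmonic polynomial of
degree `n+1`. -/
def raise {D : ℕ} (n : ℕ) (f : Fin D → Poly D) : Poly D :=
  ∑ m, X m * f m - ((D : ℂ) + 2 * (n : ℂ) - 2)⁻¹ • (r2 D * ∑ m, pderiv m (f m))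

lemma den_ne {D : ℕ} (hD : 2 ≤ D) (n : ℕ) : (D : ℂ) + 2 * ((n + 1 : ℕ) : ℂ) - 2 ≠ 0 := by
  have : (D : ℂ) + 2 * ((n + 1 : ℕ) : ℂ) - 2 = ((D + 2 * n : ℕ) : ℂ) := by push_cast; ring
  rw [this]
  exact Nat.cast_ne_zero.2 (by omega)

lemma raise_harm {D : ℕ} (hD : 2 ≤ D) (n : ℕ) (f : Fin D → Poly D) (hf : ∀ m, Harm (n + 1) (f m)) :
    Harm (n + 2) (raise (n + 1) f) := by
  have hg : Harm n (∑ m, MvPolynomial.pderiv m (f m)) :=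
    ⟨IsHomogeneous.sum _ _ _ fun m _ => ((hf m).pderiv m).1, by
      rw [lap_sum]; exact Finset.sum_eq_zero fun m _ => ((hf m).pderiv m).2⟩
  constructor
  · apply IsHomogeneous.sub
    · refine IsHomogeneous.sum _ _ _ fun m _ => ?_
      have := (isHomogeneous_X ℂ m).mul (hf m).1
      rwa [show 1 + (n + 1) = n + 2 by ring] at this
    · apply homog_smul
      have := (r2_homog (D := D)).mul hg.1
      rwa [show 2 + n = n + 2 by ring] at this
  · rw [raise, lap_sub, lap_smul, lap_sum, lap_r2_mul, hg.2, hg.1.sum_X_mul_pderiv]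
    simp only [lap_X_mul, (hf _).2, mul_zero, add_zero, ← Finset.mul_sum]
    generalize (∑ m, MvPolynomial.pderiv m (f m)) = g
    have h0 := den_ne hD n
    rw [sub_eq_zero, eq_inv_smul_iff₀ h0]
    rw [smul_eq_C_mul]
    simp only [map_sub, map_add, map_mul, map_natCast, map_ofNat, nsmul_eq_mul]
    push_cast
    ring

/-! ### Action of the building blocks on tensors -/

open Matrix in
lemma extendLast_mulVec {D l : ℕ} (P : Matrix (Fin l → Fin D) (Fin l → Fin D) ℂ)
    (A : (Fin (l + 1) → Fin D) → ℂ) (k : Fin l → Fin D) (a : Fin D) :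
    (extendLast D l P *ᵥ A) (Fin.snoc k a) = (P *ᵥ fun k' => A (Fin.snoc k' a)) k := by
  simp only [mulVec, dotProduct, sum_snoc (l := l), extendLast, Fin.snoc_castSucc, Fin.snoc_last]
  rw [Finset.sum_eq_single a]
  · simp
  · intro b _ hb
    simp [Ne.symm hb]
  · simp

lemma embAt_snoc {D l : ℕ} (M : PairMat D) (k k' : Fin l → Fin D) (a b a' b' : Fin D) :
    embAt D (l + 2) l M (Fin.snoc (Fin.snoc k a : Fin (l + 1) → Fin D) b)
      (Fin.snoc (Fin.snoc k' a' : Fin (l + 1) → Fin D) b') =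
      M (a, b) (a', b') * if k = k' then 1 else 0 := by
  unfold embAt
  rw [dif_pos (by omega)]
  have e1 : (⟨l, by omega⟩ : Fin (l + 2)) = (Fin.last l).castSucc := rfl
  have e2 : (⟨l + 1, by omega⟩ : Fin (l + 2)) = Fin.last (l + 1) := rfl
  rw [e1, e2, Fin.prod_univ_castSucc, Fin.prod_univ_castSucc]
  simp only [Fin.snoc_castSucc, Fin.snoc_last]
  congr 1
  have : ∀ m : Fin l, ¬ ((m : ℕ) = l ∨ (m : ℕ) = l + 1) := fun m => by have := m.2; omega
  simp only [Fin.val_castSucc, Fin.val_last, this, if_false, true_or, or_true, if_true, mul_one]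
  rw [Finset.prod_ite_zero]
  simp [funext_iff]

open Matrix in
lemma embAt_mulVec {D l : ℕ} (M : PairMat D) (B : (Fin (l + 2) → Fin D) → ℂ)
    (k : Fin l → Fin D) (a b : Fin D) :
    (embAt D (l + 2) l M *ᵥ B) (Fin.snoc (Fin.snoc k a : Fin (l + 1) → Fin D) b) =
      ∑ b' : Fin D, ∑ a' : Fin D, M (a, b) (a', b') *
        B (Fin.snoc (Fin.snoc k a' : Fin (l + 1) → Fin D) b') := by
  simp only [mulVec, dotProduct]
  rw [sum_snoc (l := l + 1)]
  refine Finset.sum_congr rfl fun b' _ => ?_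
  rw [sum_snoc (l := l)]
  refine Finset.sum_congr rfl fun a' _ => ?_
  simp only [embAt_snoc]
  simp

lemma MStep_apply_sum {D : ℕ} (hD : 2 ≤ D) (n : ℕ) (G : Fin D → Fin D → ℂ) (a b : Fin D) :
    ∑ b' : Fin D, ∑ a' : Fin D, MStep D n (a, b) (a', b') * G a' b' =
      ((n : ℂ) + 1)⁻¹ * (G a b + n * G b a -
        (2 * n / ((D : ℂ) + 2 * n - 2)) * (if a = b then 1 else 0) * ∑ c, G c c) := by
  have hD0 : (D : ℂ) ≠ 0 := Nat.cast_ne_zero.2 (by omega)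
  have h1 : ∑ b' : Fin D, ∑ a' : Fin D, (1 : PairMat D) (a, b) (a', b') * G a' b' = G a b := by
    rw [Finset.sum_eq_single b, Finset.sum_eq_single a]
    · simp
    · intro c _ hc
      simp [Matrix.one_apply, Ne.symm hc]
    · simp
    · intro c _ hc
      simp [Matrix.one_apply, Ne.symm hc]
    · simp
  have h2 : ∑ b' : Fin D, ∑ a' : Fin D, flipMat D (a, b) (a', b') * G a' b' = G b a := by
    rw [Finset.sum_eq_single a, Finset.sum_eq_single b]
    · simp [flipMat]
    · intro c _ hc
      simp [flipMat, Ne.symm hc]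
    · simp
    · intro c _ hc
      simp [flipMat, Ne.symm hc]
    · simp
  have h3 : ∑ b' : Fin D, ∑ a' : Fin D, traceMat D (a, b) (a', b') * G a' b' =
      (D : ℂ)⁻¹ * (if a = b then 1 else 0) * ∑ c, G c c := by
    rw [Finset.mul_sum]
    refine Finset.sum_congr rfl fun b' _ => ?_
    rw [Finset.sum_eq_single b']
    · simp [traceMat]; split_ifs <;> ring
    · intro c _ hc
      simp [traceMat, hc]
    · simp
  have : ∀ a' b', MStep D n (a, b) (a', b') * G a' b' =
      ((n : ℂ) + 1)⁻¹ * ((1 : PairMat D) (a, b) (a', b') * G a' b') +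
      (((n : ℂ) + 1)⁻¹ * n) * (flipMat D (a, b) (a', b') * G a' b') -
      (((n : ℂ) + 1)⁻¹ * (2 * (D : ℂ) * n / ((D : ℂ) + 2 * n - 2))) *
        (traceMat D (a, b) (a', b') * G a' b') := by
    intro a' b'
    simp only [MStep, Matrix.smul_apply, Matrix.add_apply, Matrix.sub_apply, smul_eq_mul]
    ring
  simp only [this, Finset.sum_add_distrib, Finset.sum_sub_distrib, ← Finset.mul_sum, h1, h2, h3]
  have : (2 * (D : ℂ) * n / ((D : ℂ) + 2 * n - 2)) * (D : ℂ)⁻¹ = 2 * n / ((D : ℂ) + 2 * n - 2) := by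
    field_simp
  rw [← this]
  ring

/-! ### Symmetry of the projector -/

open Matrix in
lemma MStep_symm (D n : ℕ) (p q : Fin D × Fin D) : MStep D n p q = MStep D n q p := by
  have h1 : (1 : PairMat D) p q = (1 : PairMat D) q p := by
    simp [Matrix.one_apply, eq_comm]
  have h2 : flipMat D p q = flipMat D q p := by
    simp only [flipMat]
    congr 1
    apply propext
    constructor <;> rintro ⟨h, h'⟩ <;> exact ⟨h'.symm, h.symm⟩
  have h3 : traceMat D p q = traceMat D q p := by
    simp only [traceMat]; ring
  simp only [MStep, Matrix.smul_apply, Matrix.add_apply, Matrix.sub_apply, h1, h2, h3]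

open Matrix in
lemma symProj_transpose (D l : ℕ) : (symProj D l)ᵀ = symProj D l := by
  induction l with
  | zero => simp [symProj]
  | succ l ih =>
    cases l with
    | zero => simp [symProj]
    | succ l =>
      have h1 : (extendLast D (l + 1) (symProj D (l + 1)))ᵀ =
          extendLast D (l + 1) (symProj D (l + 1)) := by
        ext i j
        simp only [transpose_apply, extendLast]
        congr 1
        · conv_rhs => rw [← ih]
          rfl
        · simp [eq_comm]
      have h2 : (embAt D (l + 2) l (MStep D (l + 1)))ᵀ = embAt D (l + 2) l (MStep D (l + 1)) := by
        ext i j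
        simp only [transpose_apply, embAt]
        simp only [MStep_symm D (l + 1) (j _, j _), eq_comm]
      rw [symProj, transpose_mul, transpose_mul, h1, h2, Matrix.mul_assoc]

lemma symProj_symm (D l : ℕ) (i j : Fin l → Fin D) : symProj D l i j = symProj D l j i := by
  conv_lhs => rw [← symProj_transpose]
  rfl

/-! ### Main induction -/

/-- `𝒫^l` projects onto tensors of harmonic polynomials. -/
structure Good (D l : ℕ) : Prop where
  fix : ∀ f : Poly D, Harm l f → (symProj D l).mulVec (tens l f) = tens l f
  img : ∀ A, ∃ f : Poly D, Harm l f ∧ (symProj D l).mulVec A = tens l f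

open Matrix in
lemma Good.kill {D l : ℕ} (hg : Good D l) (A : (Fin l → Fin D) → ℂ) (g : Poly D)
    (hA : Phi l A = r2 D * g) : symProj D l *ᵥ A = 0 := by
  ext i
  obtain ⟨f, hf, hfe⟩ := hg.img (Pi.single i 1)
  have : (symProj D l *ᵥ A) i = ∑ j, A j * tens l f j := by
    rw [← hfe]
    simp only [mulVec, dotProduct]
    refine Finset.sum_congr rfl fun j _ => ?_
    rw [Finset.sum_eq_single i]
    · simp [symProj_symm D l i j, mul_comm]
    · intro b _ hb; simp [hb]
    · simp
  rw [this, sum_mul_tens, hA, pr_r2_mul, hf.2]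
  simp

lemma tens_one_mulVec {D : ℕ} (A : (Fin 1 → Fin D) → ℂ) :
    tens 1 (∑ a, A (fun _ => a) • X a : Poly D) = A := by
  ext i
  simp only [tens, Finset.univ_unique, Finset.prod_singleton]
  rw [← mul_one (X _), pr_X_mul]
  simp only [map_sum, map_smul, pderiv_X']
  rw [Finset.sum_eq_single (i default)]
  · have := pr_one_C (D := D) 1
    simp only [map_one] at this
    simp [this]
    congr 1
    ext x
    rw [Subsingleton.elim x 0]
  · intro b _ hb
    have hb' : b ≠ i 0 := hb
    simp [Pi.single_apply, hb']
  · simp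

lemma good_zero (D : ℕ) : Good D 0 where
  fix f hf := by simp [symProj]
  img A := ⟨C (A default), ⟨isHomogeneous_C _ _, by simp [lap]⟩, by
    ext i
    simp [symProj, tens, pr_one_C, Subsingleton.elim i default]⟩

lemma good_one (D : ℕ) : Good D 1 where
  fix f hf := by simp [symProj]
  img A := ⟨∑ a, A (fun _ => a) • X a, ⟨IsHomogeneous.sum _ _ _ fun a _ =>
    homog_smul (isHomogeneous_X ℂ a) _, by
      rw [lap_sum]
      refine Finset.sum_eq_zero fun a _ => ?_
      rw [lap_smul]
      simp only [lap, pderiv_X', apply_ite (pderiv _)]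
      simp⟩, by
    rw [tens_one_mulVec]
    simp [symProj]⟩

open Matrix in
lemma symProj_step {D l : ℕ} (A : (Fin (l + 2) → Fin D) → ℂ) :
    symProj D (l + 2) *ᵥ A = extendLast D (l + 1) (symProj D (l + 1)) *ᵥ
      (embAt D (l + 2) l (MStep D (l + 1)) *ᵥ
        (extendLast D (l + 1) (symProj D (l + 1)) *ᵥ A)) := by
  rw [symProj, mulVec_mulVec, mulVec_mulVec]

lemma ext_snoc {D l : ℕ} {A B : (Fin (l + 1) → Fin D) → ℂ}
    (h : ∀ (k : Fin l → Fin D) (a : Fin D), A (Fin.snoc k a) = B (Fin.snoc k a)) : A = B := by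
  ext i
  have := h (Fin.init i) (i (Fin.last l))
  rwa [Fin.snoc_init_self] at this

open Matrix in
lemma good_fix_succ {D l : ℕ} (hD : 2 ≤ D) (hg : Good D (l + 1)) (f : Poly D)
    (hf : Harm (l + 2) f) : symProj D (l + 2) *ᵥ (tens (l + 2) f) = tens (l + 2) f := by
  have h1 : extendLast D (l + 1) (symProj D (l + 1)) *ᵥ (tens (l + 2) f) = tens (l + 2) f := by
    apply ext_snoc
    intro k a
    rw [extendLast_mulVec, tens_snoc]
    simp only [tens_snoc]
    exact congrFun (hg.fix _ (hf.pderiv a)) k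
  have h2 : embAt D (l + 2) l (MStep D (l + 1)) *ᵥ (tens (l + 2) f) = tens (l + 2) f := by
    apply ext_snoc
    intro k b
    revert k
    intro k
    rw [← Fin.snoc_init_self k]
    generalize Fin.init k = k'
    generalize k (Fin.last l) = a
    rw [embAt_mulVec, MStep_apply_sum hD (l + 1)
      (fun a' b' => tens (l + 2) f (Fin.snoc (Fin.snoc k' a' : Fin (l + 1) → Fin D) b'))]
    have hz : ∑ c, tens (l + 2) f (Fin.snoc (Fin.snoc k' c : Fin (l + 1) → Fin D) c) = 0 := by
      simp only [tens_snoc]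
      have := hf.2
      simp only [tens, ← map_sum]
      rw [lap] at this
      rw [this, map_zero]
    rw [hz]
    simp only [tens_snoc]
    rw [pderiv_comm' b a]
    have : ((l + 1 : ℕ) : ℂ) + 1 ≠ 0 := by exact_mod_cast Nat.succ_ne_zero (l + 1)
    field_simp
    ring
  rw [symProj_step, h1, h2, h1]

lemma Phi_add {D l : ℕ} (A B : (Fin l → Fin D) → ℂ) : Phi l (A + B) = Phi l A + Phi l B := by
  simp [Phi, add_smul, Finset.sum_add_distrib]
lemma Phi_smul {D l : ℕ} (c : ℂ) (A : (Fin l → Fin D) → ℂ) : Phi l (c • A) = c • Phi l A := by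
  simp [Phi, mul_smul, Finset.smul_sum]
lemma Phi_sub {D l : ℕ} (A B : (Fin l → Fin D) → ℂ) : Phi l (A - B) = Phi l A - Phi l B := by
  simp [Phi, sub_smul, Finset.sum_sub_distrib]

lemma tens_sum {D l : ℕ} {ι : Type*} (s : Finset ι) (f : ι → Poly D) :
    tens l (∑ i ∈ s, f i) = ∑ i ∈ s, tens l (f i) := by
  ext i; simp [tens]

open Matrix in
lemma good_img_succ {D l : ℕ} (hD : 2 ≤ D) (hg : Good D (l + 1))
    (A : (Fin (l + 2) → Fin D) → ℂ) :
    ∃ f : Poly D, Harm (l + 2) f ∧ symProj D (l + 2) *ᵥ A = tens (l + 2) f := by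
  have hB : ∀ m : Fin D, ∃ f : Poly D, Harm (l + 1) f ∧
      (symProj D (l + 1) *ᵥ fun k => A (Fin.snoc k m)) = tens (l + 1) f := fun m => hg.img _
  choose f hf hfe using hB
  have hn : ((l + 1 : ℕ) : ℂ) + 1 ≠ 0 := by exact_mod_cast Nat.succ_ne_zero (l + 1)
  have hd := den_ne hD l
  have hF := raise_harm hD l f hf
  refine ⟨(((l + 1 : ℕ) : ℂ) + 1)⁻¹ • raise (l + 1) f, hF.smul _, ?_⟩
  rw [symProj_step]
  set B := extendLast D (l + 1) (symProj D (l + 1)) *ᵥ A with hBdef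
  have hBs : ∀ (k : Fin (l + 1) → Fin D) (m : Fin D), B (Fin.snoc k m) = tens (l + 1) (f m) k := by
    intro k m
    rw [hBdef, extendLast_mulVec, hfe]
  apply ext_snoc
  intro k m
  rw [extendLast_mulVec, tens_snoc, Derivation.map_smul]
  set Cm : (Fin (l + 1) → Fin D) → ℂ :=
    fun k' => (embAt D (l + 2) l (MStep D (l + 1)) *ᵥ B) (Fin.snoc k' m) with hCm
  set F := raise (l + 1) f with hFdef
  set G : Poly D := ∑ c, pderiv c (f c) with hG
  have hGhom : G.IsHomogeneous l := IsHomogeneous.sum _ _ _ fun m _ => ((hf m).pderiv m).1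
  have hCs : ∀ a : Fin D, (fun k : Fin l → Fin D => Cm (Fin.snoc k a)) =
      (((l + 1 : ℕ) : ℂ) + 1)⁻¹ • (tens l (pderiv a (f m)) +
        ((l + 1 : ℕ) : ℂ) • tens l (pderiv m (f a)) -
        (2 * ((l + 1 : ℕ) : ℂ) / ((D : ℂ) + 2 * ((l + 1 : ℕ) : ℂ) - 2) *
          (if a = m then 1 else 0)) • tens l G) := by
    intro a
    ext k
    rw [hCm]
    simp only []
    rw [embAt_mulVec, MStep_apply_sum hD (l + 1)
      (fun a' b' => B (Fin.snoc (Fin.snoc k a' : Fin (l + 1) → Fin D) b'))]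
    simp only [hBs, tens_snoc, hG, tens_sum]
    by_cases ham : a = m <;> simp [ham]
  have hPhi : Phi (l + 1) (Cm - tens (l + 1) ((((l + 1 : ℕ) : ℂ) + 1)⁻¹ • pderiv m F)) =
      r2 D * (((((l + 1 : ℕ) : ℂ) + 1)⁻¹ * ((l + 1).factorial : ℂ) *
        ((D : ℂ) + 2 * ((l + 1 : ℕ) : ℂ) - 2)⁻¹) • pderiv m G) := by
    rw [Phi_sub, Phi_tens _ (homog_smul (hF.pderiv m).1 _), Phi_succ]
    simp only [hCs, Phi_sub, Phi_add, Phi_smul, Phi_tens _ ((hf _).pderiv _).1,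
      Phi_tens _ hGhom]
    have heul := (hf m).1.sum_X_mul_pderiv
    have hFm : pderiv m F = f m + ∑ a, X a * pderiv m (f a) -
        ((D : ℂ) + 2 * ((l + 1 : ℕ) : ℂ) - 2)⁻¹ • (2 * X m * G + r2 D * pderiv m G) := by
      rw [hFdef, raise, ← hG]
      simp only [map_sub, Derivation.map_smul, map_sum, pderiv_mul, pderiv_X', pderiv_r2]
      simp [Finset.sum_add_distrib]
    have hsum : ∑ a, X a * ((((l + 1 : ℕ) : ℂ) + 1)⁻¹ •
        ((l.factorial : ℂ) • pderiv a (f m) +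
          ((l + 1 : ℕ) : ℂ) • (l.factorial : ℂ) • pderiv m (f a) -
          (2 * ((l + 1 : ℕ) : ℂ) / ((D : ℂ) + 2 * ((l + 1 : ℕ) : ℂ) - 2) *
          (if a = m then 1 else 0)) • (l.factorial : ℂ) • G)) =
        ((((l + 1 : ℕ) : ℂ) + 1)⁻¹ * (l.factorial : ℂ)) • (∑ a, X a * pderiv a (f m) +
          ((l + 1 : ℕ) : ℂ) • ∑ a, X a * pderiv m (f a) -
          (2 * ((l + 1 : ℕ) : ℂ) / ((D : ℂ) + 2 * ((l + 1 : ℕ) : ℂ) - 2)) • (X m * G)) := by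
      have hx : X m * G = ∑ a, (if a = m then (1 : ℂ) else 0) • (X a * G) := by simp
      rw [hx]
      simp only [Finset.smul_sum, ← Finset.sum_add_distrib, ← Finset.sum_sub_distrib]
      refine Finset.sum_congr rfl fun a _ => ?_
      simp only [smul_eq_C_mul, map_mul]
      ring
    rw [hsum, heul, hFm, Nat.factorial_succ, div_eq_mul_inv]
    generalize ((D : ℂ) + 2 * ((l + 1 : ℕ) : ℂ) - 2)⁻¹ = d
    generalize (((l + 1 : ℕ) : ℂ) + 1)⁻¹ = e
    simp only [smul_eq_C_mul, map_mul, nsmul_eq_mul, map_natCast, Nat.cast_mul, map_ofNat]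
    ring
  have hk := hg.kill _ _ hPhi
  rw [mulVec_sub, hg.fix _ ((hF.pderiv m).smul _), sub_eq_zero] at hk
  exact congrFun hk k

lemma good {D : ℕ} (hD : 2 ≤ D) (l : ℕ) : Good D l := by
  induction l with
  | zero => exact good_zero D
  | succ l ih =>
    cases l with
    | zero => exact good_one D
    | succ l => exact ⟨fun f hf => good_fix_succ hD ih f hf, fun A => good_img_succ hD ih A⟩

/-! ### Consequences for the harmonic polynomials -/

lemma harmX_eq_Phi (D l : ℕ) (i : Fin l → Fin D) : harmX D l i = Phi l (symProj D l i) := rfl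

open Matrix in
lemma symProj_row {D l : ℕ} (i : Fin l → Fin D) :
    symProj D l *ᵥ (Pi.single i 1) = symProj D l i := by
  ext j
  rw [mulVec_single_one]
  exact symProj_symm D l j i

lemma harmX_harm {D : ℕ} (hD : 2 ≤ D) (l : ℕ) (i : Fin l → Fin D) : Harm l (harmX D l i) := by
  obtain ⟨f, hf, hfe⟩ := (good hD l).img (Pi.single i 1)
  rw [symProj_row] at hfe
  rw [harmX_eq_Phi, hfe, Phi_tens _ hf.1]
  exact hf.smul _

lemma tens_harmX {D : ℕ} (hD : 2 ≤ D) (l : ℕ) (i : Fin l → Fin D) :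
    tens l (harmX D l i) = (l.factorial : ℂ) • symProj D l i := by
  obtain ⟨f, hf, hfe⟩ := (good hD l).img (Pi.single i 1)
  rw [symProj_row] at hfe
  rw [harmX_eq_Phi, hfe, Phi_tens _ hf.1, tens_smul]

/-- Reproducing property. -/
lemma pr_harmX {D : ℕ} (hD : 2 ≤ D) (l : ℕ) (i : Fin l → Fin D) (f : Poly D) (hf : Harm l f) :
    pr D (harmX D l i) f = tens l f i := by
  rw [harmX_eq_Phi, ← sum_mul_tens]
  exact congrFun ((good hD l).fix f hf) i

lemma harm_ext {D : ℕ} (hD : 2 ≤ D) (l : ℕ) (E : Poly D) (hE : Harm l E)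
    (h : ∀ g, Harm l g → pr D E g = 0) : E = 0 := by
  have ht : tens l E = 0 := by
    ext j
    rw [← pr_harmX hD l j E hE, pr_symm, h _ (harmX_harm hD l j)]
    rfl
  have := Phi_tens E hE.1
  rw [ht] at this
  have h0 : (l.factorial : ℂ) ≠ 0 := by exact_mod_cast l.factorial_ne_zero
  have hz : (l.factorial : ℂ) • E = 0 := by rw [← this]; simp [Phi]
  exact (smul_eq_zero.1 hz).resolve_left h0

lemma harmX_step {D : ℕ} (hD : 2 ≤ D) (l : ℕ) (h : Fin D) (i : Fin (l + 1) → Fin D) :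
    X h * harmX D (l + 1) i - harmX D (l + 2) (Fin.cons h i) =
      ((D : ℂ) + 2 * ((l + 1 : ℕ) : ℂ) - 2)⁻¹ • (r2 D * pderiv h (harmX D (l + 1) i)) := by
  have hX := harmX_harm hD (l + 1) i
  set Y := harmX D (l + 1) i with hY
  have hr := raise_harm hD l (fun m => if m = h then Y else 0) (by
    intro m
    split_ifs
    · exact hX
    · exact ⟨isHomogeneous_zero _ _ _, by simp [lap]⟩)
  have hre : raise (l + 1) (fun m => if m = h then Y else 0) = X h * Y -
      ((D : ℂ) + 2 * ((l + 1 : ℕ) : ℂ) - 2)⁻¹ • (r2 D * pderiv h Y) := by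
    simp [raise, apply_ite (pderiv _)]
  rw [hre] at hr
  have := harm_ext hD (l + 2) _ (hr.sub (harmX_harm hD (l + 2) (Fin.cons h i))) (by
    intro g hg
    simp only [map_sub, map_smul, LinearMap.sub_apply, LinearMap.smul_apply, pr_r2_mul, hg.2,
      map_zero, smul_zero, sub_zero, pr_X_mul]
    rw [hY, pr_harmX hD _ _ _ (hg.pderiv h), pr_harmX hD _ _ _ hg, tens_cons, sub_self])
  rw [← sub_eq_zero, ← this]
  ring

lemma pderiv_harmX {D : ℕ} (hD : 2 ≤ D) (l : ℕ) (h : Fin D) (i : Fin (l + 1) → Fin D) :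
    pderiv h (harmX D (l + 1) i) = ((l : ℂ) + 1) •
      ∑ j : Fin l → Fin D, symProj D (l + 1) i (Fin.cons h j) • harmX D l j := by
  have hX := (harmX_harm hD (l + 1) i).pderiv h
  set Z := pderiv h (harmX D (l + 1) i) with hZ
  have h0 : (l.factorial : ℂ) ≠ 0 := by exact_mod_cast l.factorial_ne_zero
  have ht : ∀ j, tens l Z j = ((l + 1).factorial : ℂ) * symProj D (l + 1) i (Fin.cons h j) := by
    intro j
    rw [hZ, ← tens_cons, tens_harmX hD]
    rfl
  have hs : ∑ j : Fin l → Fin D, tens l Z j • harmX D l j = (l.factorial : ℂ) • Z := by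
    rw [← Phi_tens Z hX.1]
    conv_rhs => rw [← (good hD l).fix Z hX]
    simp only [harmX, Phi, Matrix.mulVec, dotProduct, Finset.smul_sum, Finset.sum_smul, smul_smul]
    rw [Finset.sum_comm]
    refine Finset.sum_congr rfl fun j _ => Finset.sum_congr rfl fun k _ => ?_
    rw [symProj_symm D l j k, mul_comm]
  have : (l.factorial : ℂ) • Z = (l.factorial : ℂ) • (((l : ℂ) + 1) •
      ∑ j : Fin l → Fin D, symProj D (l + 1) i (Fin.cons h j) • harmX D l j) := by
    rw [← hs]
    simp only [ht, Finset.smul_sum, smul_smul, Nat.factorial_succ]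
    refine Finset.sum_congr rfl fun j _ => ?_
    congr 1
    push_cast
    ring
  exact smul_right_injective _ h0 this

/-- For `l ≥ 1` (written as `l+1`):
`x^h X_l^{i_1…i_l} − X_{l+1}^{h i_1…i_l}
  = (l/(D+2l−2)) · r² · 𝒫^l{}^{i_1…i_l}_{h j_2…j_l} X_{l−1}^{j_2…j_l}`. -/
theorem statement4 (D : ℕ) (hD : 2 ≤ D) (l : ℕ) (h : Fin D) (i : Fin (l + 1) → Fin D) :
    X h * harmX D (l + 1) i - harmX D (l + 2) (Fin.cons h i) =
      (((l : ℂ) + 1) / ((D : ℂ) + 2 * ((l : ℂ) + 1) - 2)) •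
        (r2 D * ∑ j : Fin l → Fin D, symProj D (l + 1) i (Fin.cons h j) • harmX D l j) := by
  rw [harmX_step hD, pderiv_harmX hD, mul_smul_comm, smul_smul, div_eq_mul_inv]
  congr 1
  push_cast
  ring


end Fuzzy
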